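/- Let 1 < p < ∞, let k ∈ ℕ, let ν ∈ ℝ and let (k−1)p−1 < γ < kp−1. Then there exist constants 0 < c ≤ C < ∞, independent of u, such that for every smooth compactly supported function u : 𝒟 → ℂ (support a compact subset of the open set 𝒟): c · Σ_{|α| ≤ k} ( ∫_𝒟 |∂^α u(x)|^p · w_{γ+(|α|−k)p, ν+(|α|−k)p}(x) dx )^{1/p} ≤ Σ_{|α| ≤ k} ( ∫_𝒟 |∂^α u(x)|^p · w_{γ, ν+(|α|−k)p}(x) dx )^{1/p} ≤ C · Σ_{|α| ≤ k} ( ∫_𝒟 |∂^α u(x)|^p · w_{γ+(|α|−k)p, ν+(|α|−k)p}(x) dx )^{1/p}. -/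

import Mathlib

open MeasureTheory Set Real
open scoped ENNReal

noncomputable section

/-- The planar angular domain with opening angle `κ`, as a subset of `ℝ × ℝ`. -/
def D2 (κ : ℝ) : Set (ℝ × ℝ) :=
  {x | ∃ r φ : ℝ, 0 < r ∧ 0 < φ ∧ φ < κ ∧ x = (r * Real.cos φ, r * Real.sin φ)}

/-- Partial derivative in the first variable. -/
def pd1 (f : ℝ × ℝ → ℂ) : ℝ × ℝ → ℂ := fun x => deriv (fun s => f (s, x.2)) x.1

/-- Partial derivative in the second variable. -/
def pd2 (f : ℝ × ℝ → ℂ) : ℝ × ℝ → ℂ := fun x => deriv (fun s => f (x.1, s)) x.2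

/-- Iterated partial derivative `∂_{x₁}^{α₁} ∂_{x₂}^{α₂} f` for a multi-index `α`. -/
def pdMix (α : ℕ × ℕ) (f : ℝ × ℝ → ℂ) : ℝ × ℝ → ℂ := pd1^[α.1] (pd2^[α.2] f)

/-- The Euler-coordinate parametrization `(z, φ) ↦ (eᶻ cos φ, eᶻ sin φ)`. -/
def eulerMap (p : ℝ × ℝ) : ℝ × ℝ := (Real.exp p.1 * Real.cos p.2, Real.exp p.1 * Real.sin p.2)

/-- The strip `ℝ × (0, κ)`. -/
def strip (κ : ℝ) : Set (ℝ × ℝ) := {p | 0 < p.2 ∧ p.2 < κ}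

/-- Euclidean norm on `ℝ × ℝ`. -/
def enorm2 (x : ℝ × ℝ) : ℝ := Real.sqrt (x.1 ^ 2 + x.2 ^ 2)

/-- Euclidean distance from `x` to the boundary of `𝒟`. -/
def rhoD2 (κ : ℝ) (x : ℝ × ℝ) : ℝ :=
  sInf ((fun y => enorm2 (x - y)) '' frontier (D2 κ))

/-- The mixed power weight `w_{γ,ν}(x) = ρ_∘(x)^{ν-γ} ρ_𝒟(x)^γ`. -/
def wgt2 (κ γ ν : ℝ) (x : ℝ × ℝ) : ℝ := enorm2 x ^ (ν - γ) * rhoD2 κ x ^ γ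

/-- The multi-indices `α ∈ ℕ₀²` with `|α| ≤ k`, as a finset. -/
def idx (k : ℕ) : Finset (ℕ × ℕ) :=
  Finset.filter (fun α : ℕ × ℕ => α.1 + α.2 ≤ k)
    (Finset.range (k + 1) ×ˢ Finset.range (k + 1))

/-- auxiliary quadratic -/
def qf (κ φ : ℝ) : ℝ := φ * (κ - φ)

lemma D2_eq_image (κ : ℝ) :
    D2 κ = polarCoord.symm '' (Ioi (0:ℝ) ×ˢ Ioo 0 κ) := by
  ext x
  constructor
  · rintro ⟨r, φ, hr, h0, h1, rfl⟩
    exact ⟨(r, φ), ⟨hr, h0, h1⟩, rfl⟩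
  · rintro ⟨⟨r, φ⟩, ⟨hr, h0, h1⟩, rfl⟩
    exact ⟨r, φ, hr, h0, h1, rfl⟩

lemma isOpen_D2 (κ : ℝ) : IsOpen (D2 κ) := by
  have h : D2 κ = Complex.equivRealProdCLM '' (Complex.exp '' {z : ℂ | 0 < z.im ∧ z.im < κ}) := by
    ext x
    constructor
    · rintro ⟨r, φ, hr, h0, h1, rfl⟩
      refine ⟨_, ⟨⟨Real.log r, φ⟩, ⟨h0, h1⟩, rfl⟩, ?_⟩
      change ((Complex.exp ⟨Real.log r, φ⟩).re, (Complex.exp ⟨Real.log r, φ⟩).im) = _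
      simp [Complex.exp_re, Complex.exp_im, Real.exp_log hr]
    · rintro ⟨_, ⟨z, ⟨h0, h1⟩, rfl⟩, rfl⟩
      refine ⟨Real.exp z.re, z.im, Real.exp_pos _, h0, h1, ?_⟩
      change ((Complex.exp z).re, (Complex.exp z).im) = _
      simp [Complex.exp_re, Complex.exp_im]
  rw [h]
  apply Complex.equivRealProdCLM.toHomeomorph.isOpenMap
  apply Complex.isOpenMap_exp
  exact (isOpen_lt continuous_const Complex.continuous_im).inter
    (isOpen_lt Complex.continuous_im continuous_const)

lemma polar_unique {r s a b : ℝ} (hr : 0 < r) (hs : 0 < s) (h1 : r * cos a = s * cos b)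
    (h2 : r * sin a = s * sin b) : r = s ∧ cos (a - b) = 1 := by
  have e : r = s := by
    have : r ^ 2 = s ^ 2 := by
      have : r^2 * (sin a ^2 + cos a ^2) = s^2 * (sin b ^2 + cos b ^2) := by
        linear_combination (r * cos a + s * cos b) * h1 + (r * sin a + s * sin b) * h2
      simpa using this
    exact (pow_left_inj₀ hr.le hs.le two_ne_zero).1 this
  subst e
  refine ⟨rfl, ?_⟩
  have h1' := mul_left_cancel₀ hr.ne' h1
  have h2' := mul_left_cancel₀ hr.ne' h2
  rw [cos_sub, h1', h2']
  nlinarith [sin_sq_add_cos_sq b]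

lemma angle_eq_zero {t : ℝ} (h : cos t = 1) (h1 : -(2*π) < t) (h2 : t < 2 * π) : t = 0 :=
  (Real.cos_eq_one_iff_of_lt_of_lt h1 h2).1 h

lemma injOn_polar {κ : ℝ} (hκ' : κ < 2 * π) :
    InjOn polarCoord.symm (Ioi (0:ℝ) ×ˢ Ioo 0 κ) := by
  rintro ⟨r, a⟩ ⟨hr, ha0, ha1⟩ ⟨s, b⟩ ⟨hs, hb0, hb1⟩ h
  simp only [polarCoord_symm_apply, Prod.mk.injEq] at h
  simp only [mem_Ioi] at *
  obtain ⟨h1, h2⟩ := polar_unique hr hs h.1 h.2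
  have := angle_eq_zero h2 (by linarith) (by linarith)
  rw [h1, show a = b by linarith]

lemma lintegral_D2 {κ : ℝ} (hκ' : κ < 2 * π) (g : ℝ × ℝ → ℝ≥0∞) :
    ∫⁻ x in D2 κ, g x = ∫⁻ x in Ioi (0:ℝ) ×ˢ Ioo 0 κ,
      ENNReal.ofReal x.1 * g (x.1 * cos x.2, x.1 * sin x.2) := by
  have hm : MeasurableSet (Ioi (0:ℝ) ×ˢ Ioo (0:ℝ) κ) := measurableSet_Ioi.prod measurableSet_Ioo
  rw [D2_eq_image, lintegral_image_eq_lintegral_abs_det_fderiv_mul _ hm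
    (fun x _ => (hasFDerivAt_polarCoord_symm x).hasFDerivWithinAt) (injOn_polar hκ')]
  apply setLIntegral_congr_fun hm
  rintro ⟨r, φ⟩ ⟨hr, -⟩
  simp only [det_fderivPolarCoordSymm, abs_of_pos (mem_Ioi.1 hr)]
  rfl

lemma not_mem_D2_zero (κ : ℝ) : ((0:ℝ), (0:ℝ)) ∉ D2 κ := by
  rintro ⟨r, φ, hr, h0, h1, h⟩
  simp only [Prod.mk.injEq] at h
  have := sin_sq_add_cos_sq φ
  have hc : cos φ = 0 := by simpa [hr.ne'] using h.1.symm
  have hs : sin φ = 0 := by simpa [hr.ne'] using h.2.symm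
  rw [hc, hs] at this; norm_num at this

lemma not_mem_D2 {κ : ℝ} (hκ' : κ < 2 * π) {r t : ℝ} (hr : 0 < r) (ht : t = 0 ∨ t = κ) :
    (r * cos t, r * sin t) ∉ D2 κ := by
  rintro ⟨s, φ, hs, h0, h1, h⟩
  simp only [Prod.mk.injEq] at h
  obtain ⟨-, h2⟩ := polar_unique hr hs h.1 h.2
  rcases ht with rfl | rfl
  · have := angle_eq_zero h2 (by linarith) (by linarith)
    linarith
  · have := angle_eq_zero h2 (by linarith) (by linarith)
    linarith

lemma mem_frontier_D2 {κ : ℝ} (hκ : 0 < κ) (hκ' : κ < 2 * π) {r t : ℝ} (hr : 0 < r)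
    (ht : t = 0 ∨ t = κ) : (r * cos t, r * sin t) ∈ frontier (D2 κ) := by
  rw [(isOpen_D2 κ).frontier_eq]
  refine ⟨?_, not_mem_D2 hκ' hr ht⟩
  have ht' : t ∈ closure (Ioo 0 κ) := by
    rw [closure_Ioo hκ.ne]
    rcases ht with rfl | rfl
    · exact ⟨le_rfl, hκ.le⟩
    · exact ⟨hκ.le, le_rfl⟩
  have hc : Continuous (fun t : ℝ => (r * cos t, r * sin t)) := by fun_prop
  exact map_mem_closure (f := fun t : ℝ => (r * cos t, r * sin t)) hc ht' (fun φ hφ => ⟨r, φ, hr, hφ.1, hφ.2, rfl⟩)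

lemma zero_mem_frontier_D2 {κ : ℝ} (hκ : 0 < κ) : ((0:ℝ), (0:ℝ)) ∈ frontier (D2 κ) := by
  rw [(isOpen_D2 κ).frontier_eq]
  refine ⟨?_, not_mem_D2_zero κ⟩
  have ht' : (0:ℝ) ∈ closure (Ioi 0) := by
    rw [closure_Ioi]; exact self_mem_Ici
  have hc : Continuous (fun t : ℝ => (t * cos (κ/2), t * sin (κ/2))) := by fun_prop
  have := map_mem_closure hc ht' (t := D2 κ)
    (fun s hs => ⟨s, κ/2, hs, by linarith, by linarith, rfl⟩)
  simpa using this

lemma enorm2_polar {r : ℝ} (hr : 0 ≤ r) (φ : ℝ) : enorm2 (r * cos φ, r * sin φ) = r := by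
  unfold enorm2
  rw [show (r * cos φ, r * sin φ).1 ^ 2 + (r * cos φ, r * sin φ).2 ^ 2 = r ^ 2 by
    simp only; linear_combination r ^ 2 * sin_sq_add_cos_sq φ]
  exact sqrt_sq hr

lemma rhoD2_le (κ : ℝ) (x : ℝ × ℝ) {y : ℝ × ℝ} (hy : y ∈ frontier (D2 κ)) :
    rhoD2 κ x ≤ enorm2 (x - y) := by
  apply csInf_le
  · exact ⟨0, by rintro _ ⟨z, -, rfl⟩; exact sqrt_nonneg _⟩
  · exact ⟨y, hy, rfl⟩

lemma rhoD2_le_norm {κ : ℝ} (hκ : 0 < κ) (x : ℝ × ℝ) : rhoD2 κ x ≤ enorm2 x := by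
  have := rhoD2_le κ x (zero_mem_frontier_D2 hκ)
  simpa [enorm2] using this

lemma enorm2_sub_polar_sq (r s a b : ℝ) :
    ((r * cos a, r * sin a) - (s * cos b, s * sin b) : ℝ × ℝ).1 ^ 2 +
      ((r * cos a, r * sin a) - (s * cos b, s * sin b) : ℝ × ℝ).2 ^ 2 =
      r ^ 2 + s ^ 2 - 2 * r * s * cos (b - a) := by
  simp only [Prod.mk_sub_mk]
  rw [cos_sub]
  linear_combination r ^ 2 * sin_sq_add_cos_sq a + s ^ 2 * sin_sq_add_cos_sq b

lemma rhoD2_upper {κ : ℝ} (hκ : 0 < κ) (hκ' : κ < 2 * π) {r φ : ℝ} (hr : 0 < r) (h0 : 0 < φ)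
    (h1 : φ < κ) : rhoD2 κ (r * cos φ, r * sin φ) ≤ (2 / κ) * (r * qf κ φ) := by
  have key : ∀ t, (t = 0 ∨ t = κ) → rhoD2 κ (r * cos φ, r * sin φ) ≤ r * |t - φ| := by
    intro t ht
    refine (rhoD2_le κ _ (mem_frontier_D2 hκ hκ' hr ht)).trans ?_
    unfold enorm2
    rw [enorm2_sub_polar_sq]
    apply Real.sqrt_le_iff.2
    refine ⟨by positivity, ?_⟩
    rw [mul_pow, sq_abs]
    nlinarith [Real.one_sub_sq_div_two_le_cos (x := t - φ), sq_nonneg r]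
  have e1 := key 0 (Or.inl rfl)
  have e2 := key κ (Or.inr rfl)
  rw [zero_sub, abs_neg, abs_of_pos h0] at e1
  rw [abs_of_pos (by linarith)] at e2
  unfold qf
  rw [div_mul_eq_mul_div, le_div_iff₀ hκ]
  rcases le_total φ (κ/2) with h | h
  · have : r * φ * κ ≤ 2 * (r * (φ * (κ - φ))) := by
      nlinarith [mul_pos hr h0]
    nlinarith
  · have : r * (κ - φ) * κ ≤ 2 * (r * (φ * (κ - φ))) := by
      nlinarith [mul_pos hr (sub_pos.2 h1)]
    nlinarith

lemma exists_polar (y : ℝ × ℝ) : ∃ s θ : ℝ, 0 ≤ s ∧ 0 < θ ∧ θ ≤ 2 * π ∧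
    y = (s * cos θ, s * sin θ) := by
  set z : ℂ := ⟨y.1, y.2⟩
  have h1 := Complex.norm_mul_cos_arg z
  have h2 := Complex.norm_mul_sin_arg z
  have h3 := Complex.neg_pi_lt_arg z
  have h4 := Complex.arg_le_pi z
  by_cases h : 0 < Complex.arg z
  · refine ⟨‖z‖, Complex.arg z, norm_nonneg _, h, by linarith [pi_pos], ?_⟩
    rw [h1, h2]
  · refine ⟨‖z‖, Complex.arg z + 2 * π, norm_nonneg _, by linarith, by linarith, ?_⟩
    rw [cos_add_two_pi, sin_add_two_pi, h1, h2]

lemma rhoD2_lower {κ : ℝ} (hκ : 0 < κ) {r φ : ℝ} (hr : 0 < r) (h0 : 0 < φ)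
    (h1 : φ < κ) (hκ' : κ < 2 * π) :
    (1 / (π * κ)) * (r * qf κ φ) ≤ rhoD2 κ (r * cos φ, r * sin φ) := by
  apply le_csInf
  · exact ⟨_, _, zero_mem_frontier_D2 hκ, rfl⟩
  rintro _ ⟨y, hy, rfl⟩
  rw [(isOpen_D2 κ).frontier_eq] at hy
  replace hy := hy.2
  have : ∃ s θ : ℝ, 0 ≤ s ∧ κ ≤ θ ∧ θ ≤ 2 * π ∧ y = (s * cos θ, s * sin θ) := by
    obtain ⟨s, θ, hs, ht0, ht1, rfl⟩ := exists_polar y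
    rcases hs.eq_or_lt with rfl | hs
    · exact ⟨0, κ, le_rfl, le_rfl, hκ'.le, by simp⟩
    · refine ⟨s, θ, hs.le, ?_, ht1, rfl⟩
      by_contra! h
      exact hy ⟨s, θ, hs, ht0, h, rfl⟩
  obtain ⟨s, θ, hs, ht0, ht1, rfl⟩ := this
  dsimp only [enorm2]
  rw [enorm2_sub_polar_sq]
  apply Real.le_sqrt_of_sq_le
  set d := (θ - φ) / 2 with hd
  have hcos : cos (θ - φ) = 1 - 2 * sin d ^ 2 := by
    rw [show θ - φ = 2 * d by rw [hd]; ring, cos_two_mul]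
    linarith [sin_sq_add_cos_sq d]
  have hsin : qf κ φ / (π * κ) ≤ sin d := by
    have hq : ∀ t, φ / 2 ≤ t ∨ (κ - φ) / 2 ≤ t → qf κ φ / (π * κ) ≤ 2 / π * t := by
      intro t ht
      rw [div_le_iff₀ (by positivity), show 2 / π * t * (π * κ) = 2 * t * κ by field_simp]
      unfold qf
      rcases ht with ht | ht <;> nlinarith
    rcases le_total d (π / 2) with h | h
    · refine (hq d (Or.inr (by linarith))).trans ?_
      exact Real.mul_le_sin (by linarith) h
    · rw [← sin_pi_sub]
      refine (hq (π - d) (Or.inl (by linarith))).trans ?_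
      exact Real.mul_le_sin (by linarith) (by linarith)
  have hq0 : 0 ≤ qf κ φ / (π * κ) := by
    unfold qf
    have := sub_pos.2 h1
    positivity
  have e1 : (1 / (π * κ) * (r * qf κ φ)) ^ 2 ≤ r ^ 2 * sin d ^ 2 := by
    rw [show 1 / (π * κ) * (r * qf κ φ) = r * (qf κ φ / (π * κ)) by ring, mul_pow]
    gcongr
  refine e1.trans ?_
  rw [hcos]
  have hs1 : sin d ^ 2 ≤ 1 := sin_sq_le_one d
  have hs0 := sq_nonneg (sin d)
  set S := sin d ^ 2
  rcases le_total S (1/2) with h | h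
  · nlinarith [sq_nonneg (s - r * (1 - 2 * S)), mul_nonneg (mul_nonneg (sq_nonneg r) hs0) (by linarith : 0 ≤ 3 - 4 * S)]
  · nlinarith [mul_nonneg (mul_nonneg hr.le hs) (by linarith : 0 ≤ 2 * S - 1), sq_nonneg s, mul_nonneg (sq_nonneg r) (by linarith : 0 ≤ 1 - S)]

lemma rpow_compare {c₁ c₂ : ℝ} (h1 : 0 < c₁) (h2 : 0 < c₂) (e : ℝ) : ∃ K : ℝ, 0 < K ∧
    ∀ x y : ℝ, 0 < y → c₁ * y ≤ x → x ≤ c₂ * y → x ^ e ≤ K * y ^ e ∧ y ^ e ≤ K * x ^ e := by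
  have aux : ∀ {c₁ c₂ : ℝ}, 0 < c₁ → 0 < c₂ → ∀ x y : ℝ, 0 < y → c₁ * y ≤ x → x ≤ c₂ * y →
      x ^ e ≤ (c₁ ^ e + c₂ ^ e) * y ^ e := by
    intro c₁ c₂ h1 h2 x y hy hx1 hx2
    have hx : 0 < x := lt_of_lt_of_le (by positivity) hx1
    rcases le_total 0 e with he | he
    · have := Real.rpow_le_rpow hx.le hx2 he
      rw [mul_rpow h2.le hy.le] at this
      have h3 : 0 ≤ c₁ ^ e * y ^ e := by positivity
      linarith
    · have := Real.rpow_le_rpow_of_nonpos (by positivity) hx1 he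
      rw [mul_rpow h1.le hy.le] at this
      have h3 : 0 ≤ c₂ ^ e * y ^ e := by positivity
      linarith
  refine ⟨(c₁ ^ e + c₂ ^ e) + (c₂⁻¹ ^ e + c₁⁻¹ ^ e), by positivity, ?_⟩
  intro x y hy hx1 hx2
  have hx : 0 < x := lt_of_lt_of_le (by positivity) hx1
  have a1 := aux h1 h2 x y hy hx1 hx2
  have a2 := aux (inv_pos.2 h2) (inv_pos.2 h1) y x hx (by rw [inv_mul_le_iff₀ h2]; exact hx2)
    (by rw [le_inv_mul_iff₀ h1]; exact hx1)
  have b1 : 0 ≤ (c₂⁻¹ ^ e + c₁⁻¹ ^ e) * y ^ e := by positivity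
  have b2 : 0 ≤ (c₁ ^ e + c₂ ^ e) * x ^ e := by positivity
  constructor <;> linarith

lemma wgt2_compare {κ : ℝ} (hκ : 0 < κ) (hκ' : κ < 2 * π) (g n : ℝ) : ∃ K : ℝ, 0 < K ∧
    ∀ r φ : ℝ, 0 < r → 0 < φ → φ < κ →
      wgt2 κ g n (r * cos φ, r * sin φ) ≤ K * (r ^ n * qf κ φ ^ g) ∧
      r ^ n * qf κ φ ^ g ≤ K * wgt2 κ g n (r * cos φ, r * sin φ) := by
  obtain ⟨K, hK, h⟩ := rpow_compare (c₁ := 1 / (π * κ)) (c₂ := 2 / κ) (by positivity)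
    (by positivity) g
  refine ⟨K, hK, fun r φ hr h0 h1 => ?_⟩
  have hq : 0 < qf κ φ := mul_pos h0 (sub_pos.2 h1)
  obtain ⟨a, b⟩ := h _ (r * qf κ φ) (by positivity) (rhoD2_lower hκ hr h0 h1 hκ')
    (rhoD2_upper hκ hκ' hr h0 h1)
  unfold wgt2
  rw [enorm2_polar hr.le]
  rw [mul_rpow hr.le hq.le] at a b
  have e : r ^ n = r ^ (n - g) * r ^ g := by rw [← rpow_add hr]; ring_nf
  have hp : 0 < r ^ (n - g) := by positivity
  constructor
  · calc _ ≤ r ^ (n - g) * (K * (r ^ g * qf κ φ ^ g)) := by gcongr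
      _ = _ := by rw [e]; ring
  · calc _ = r ^ (n - g) * (r ^ g * qf κ φ ^ g) := by rw [e]; ring
      _ ≤ r ^ (n - g) * (K * rhoD2 κ (r * cos φ, r * sin φ) ^ g) := by gcongr
      _ = _ := by ring
lemma absorb {p : ℝ} (hp : 1 < p) {ε X Y : ℝ} (hε : 0 < ε) (hX : 0 ≤ X) (hY : 0 ≤ Y) :
    X ^ (p - 1) * Y ≤ ε * X ^ p + ε ^ (1 - p) * Y ^ p := by
  have hXp : X ^ p = X ^ (p - 1) * X := by
    rw [← rpow_add_one' hX (by linarith)]; ring_nf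
  rcases le_total Y (ε * X) with h | h
  · have : X ^ (p - 1) * Y ≤ X ^ (p - 1) * (ε * X) := by gcongr
    have h2 : 0 ≤ ε ^ (1 - p) * Y ^ p := by positivity
    rw [hXp]; linarith
  · have h1 : X ≤ ε⁻¹ * Y := by rw [le_inv_mul_iff₀ hε]; exact h
    have hYp : Y ^ p = Y ^ (p - 1) * Y := by
      rw [← rpow_add_one' hY (by linarith)]; ring_nf
    have h3 : X ^ (p - 1) ≤ ε ^ (1 - p) * Y ^ (p - 1) := by
      calc X ^ (p - 1) ≤ (ε⁻¹ * Y) ^ (p - 1) := by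
            apply rpow_le_rpow hX h1 (by linarith)
        _ = _ := by
          rw [mul_rpow (by positivity) hY, inv_rpow hε.le, ← rpow_neg hε.le]; ring_nf
    have h4 : 0 ≤ ε * X ^ p := by positivity
    calc X ^ (p - 1) * Y ≤ ε ^ (1 - p) * Y ^ (p - 1) * Y := by gcongr
      _ = ε ^ (1 - p) * Y ^ p := by rw [hYp]; ring
      _ ≤ _ := by linarith

lemma hardy1 {κ p b : ℝ} (hκ : 0 < κ) (hp : 1 < p) (hb : b ≠ p - 1) : ∃ C : ℝ, 0 < C ∧
    ∀ f : ℝ → ℂ, ContDiff ℝ 1 f → (∀ᶠ φ in nhds 0, f φ = 0) → (∀ᶠ φ in nhds κ, f φ = 0) →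
      ∫⁻ φ in Ioo 0 κ, ENNReal.ofReal (‖f φ‖ ^ p * qf κ φ ^ (b - p)) ≤
      ENNReal.ofReal C *
        ∫⁻ φ in Ioo 0 κ, ENNReal.ofReal ((‖deriv f φ‖ ^ p + ‖f φ‖ ^ p) * qf κ φ ^ b) := by
  set β := b - p + 1 with hβ
  have hβ0 : β ≠ 0 := by intro h; apply hb; linarith
  have hp0 : 0 < p := by linarith
  set M1 := p * κ / |β| with hM1
  set M2 := 4 + 2 / |β| with hM2
  have hM1p : 0 < M1 := by positivity
  have hM2p : 0 < M2 := by positivity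
  set ε1 := κ ^ 2 / (4 * M1) with hε1
  set ε2 := κ ^ 2 / (4 * M2) with hε2
  have hε1p : 0 < ε1 := by positivity
  have hε2p : 0 < ε2 := by positivity
  set C0 := M1 * ε1 ^ (1 - p) + M2 * ε2 ^ (1 - p) with hC0
  have hC0p : 0 < C0 := by positivity
  refine ⟨C0 / (κ ^ 2 / 2), by positivity, fun f hf hf0 hfκ => ?_⟩
  -- the interval
  obtain ⟨s, t, hs0, hst, htκ, hfs, hft⟩ : ∃ s t : ℝ, 0 < s ∧ s ≤ t ∧ t < κ ∧
      (∀ φ, 0 ≤ φ → φ ≤ s → f φ = 0) ∧ (∀ φ, t ≤ φ → φ ≤ κ → f φ = 0) := by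
    obtain ⟨δ1, h1, h1'⟩ := Metric.eventually_nhds_iff.1 hf0
    obtain ⟨δ2, h2, h2'⟩ := Metric.eventually_nhds_iff.1 hfκ
    refine ⟨min (δ1 / 2) (κ / 2), max (κ - δ2 / 2) (κ / 2), by positivity, ?_, ?_, ?_, ?_⟩
    · exact (min_le_right _ _).trans (le_max_right _ _)
    · apply max_lt <;> linarith
    · intro φ h0 hφ
      apply h1'
      have := hφ.trans (min_le_left _ _)
      rw [Real.dist_eq, sub_zero, abs_of_nonneg h0]; linarith
    · intro φ hφ hφκ
      apply h2'
      have := (le_max_left _ _).trans hφ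
      rw [Real.dist_eq, abs_of_nonpos (by linarith)]; linarith
  have hq : ∀ φ, φ ∈ Icc s t → 0 < qf κ φ := fun φ hφ =>
    mul_pos (by linarith [hφ.1]) (by linarith [hφ.2])
  set h : ℝ → ℝ := fun φ => ‖f φ‖ ^ p with hh
  have hhC : ContDiff ℝ 1 h := hf.norm_rpow hp
  have hfd : Differentiable ℝ f := hf.differentiable one_ne_zero
  have hh' : ∀ φ, |deriv h φ| ≤ p * ‖f φ‖ ^ (p - 1) * ‖deriv f φ‖ := by
    intro φ
    have := norm_fderiv_norm_rpow_le hfd hp (x := φ)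
    rwa [← norm_deriv_eq_norm_fderiv, ← norm_deriv_eq_norm_fderiv] at this
  set W' : ℝ → ℝ := fun φ => deriv h φ * (qf κ φ ^ β * (κ - 2 * φ) / β) +
    h φ * (κ ^ 2 * qf κ φ ^ (β - 1) - (4 + 2 / β) * qf κ φ ^ β) with hW'
  have hqd : ∀ φ, HasDerivAt (qf κ) (κ - 2 * φ) φ := by
    intro φ
    have := (hasDerivAt_id φ).mul ((hasDerivAt_id φ).const_sub κ)
    convert! this using 1
    simp; ring
  have hW : ∀ φ ∈ Icc s t, HasDerivAt (fun φ => h φ * (qf κ φ ^ β * (κ - 2 * φ) / β)) (W' φ) φ := by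
    intro φ hφ
    have hqp := hq φ hφ
    have d1 : HasDerivAt h (deriv h φ) φ := (hhC.differentiable one_ne_zero φ).hasDerivAt
    have d2 := (hqd φ).rpow_const (p := β) (Or.inl hqp.ne')
    have d3 : HasDerivAt (fun φ : ℝ => κ - 2 * φ) (-2) φ := by
      simpa using ((hasDerivAt_id φ).const_mul 2).const_sub κ
    have d4 := d1.mul ((d2.mul d3).div_const β)
    convert! d4 using 1
    simp only [hW', Pi.mul_apply]
    have e : qf κ φ ^ β = qf κ φ ^ (β - 1) * qf κ φ := by
      rw [← rpow_add_one hqp.ne']; ring_nf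
    rw [e]
    have e2 : κ ^ 2 = (κ - 2 * φ) ^ 2 + 4 * qf κ φ := by unfold qf; ring
    rw [e2]
    field_simp
    ring
  have hqc : Continuous (qf κ) := by unfold qf; fun_prop
  have hqr : ∀ e : ℝ, ContinuousOn (fun φ => qf κ φ ^ e) (Icc s t) := fun e =>
    hqc.continuousOn.rpow_const (fun φ hφ => Or.inl (hq φ hφ).ne')
  have hhc : Continuous h := hhC.continuous
  have hhc' : Continuous (deriv h) := hhC.continuous_deriv le_rfl
  have hfc : Continuous (fun φ => ‖deriv f φ‖ ^ p) :=
    (hf.continuous_deriv le_rfl).norm.rpow_const (fun _ => Or.inr hp0.le)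
  have hW'c : ContinuousOn W' (Icc s t) := by
    have h1 := hqr β
    have h2 := hqr (β - 1)
    have h3 := hhc'.continuousOn (s := Icc s t)
    have h4 := hhc.continuousOn (s := Icc s t)
    have h5 : ContinuousOn (fun φ : ℝ => κ - 2 * φ) (Icc s t) := by fun_prop
    exact (h3.mul ((h1.mul h5).div_const β)).add
      (h4.mul ((h2.const_mul _).sub (h1.const_mul _)))
  have hpt : ∀ φ ∈ Icc s t, κ ^ 2 / 2 * (h φ * qf κ φ ^ (b - p)) - W' φ ≤
      C0 * ((‖deriv f φ‖ ^ p + ‖f φ‖ ^ p) * qf κ φ ^ b) := by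
    intro φ hφ
    have hqp := hq φ hφ
    set q := qf κ φ with hqdef
    set Q := q ^ (b - p) with hQ
    have hQ0 : 0 < Q := by positivity
    have eb : q ^ b = Q * q ^ p := by rw [hQ, ← rpow_add hqp]; ring_nf
    have eβ : q ^ β = Q * q := by rw [hQ, ← rpow_add_one hqp.ne']
    have eβ1 : q ^ (β - 1) = Q := by rw [hQ, hβ]; ring_nf
    have hX := norm_nonneg (f φ)
    have hY := norm_nonneg (deriv f φ)
    set X := ‖f φ‖ with hXd
    set Y := ‖deriv f φ‖ with hYd
    have a1 := absorb hp hε1p hX (mul_nonneg hqp.le hY)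
    have a2 : q * X ^ p ≤ ε2 * X ^ p + ε2 ^ (1 - p) * (q ^ p * X ^ p) := by
      have := absorb hp hε2p hX (mul_nonneg hqp.le hX)
      rw [mul_rpow hqp.le hX] at this
      have e : X ^ (p - 1) * (q * X) = q * X ^ p := by
        have : X ^ p = X ^ (p - 1) * X := by
          rw [← rpow_add_one' hX (by linarith)]; ring_nf
        rw [this]; ring
      rwa [e] at this
    rw [mul_rpow hqp.le hY] at a1
    have t1 : -(deriv h φ * (q ^ β * (κ - 2 * φ) / β)) ≤ M1 * (X ^ (p - 1) * (q * Y)) * Q := by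
      calc -(deriv h φ * (q ^ β * (κ - 2 * φ) / β)) ≤ |deriv h φ * (q ^ β * (κ - 2 * φ) / β)| :=
            neg_le_abs _
        _ = |deriv h φ| * ((Q * q) * |κ - 2 * φ| / |β|) := by
            rw [abs_mul, abs_div, abs_mul, eβ, abs_of_pos (mul_pos hQ0 hqp)]
        _ ≤ (p * X ^ (p - 1) * Y) * ((Q * q) * κ / |β|) := by
            have hk : |κ - 2 * φ| ≤ κ := by
              rw [abs_le]; constructor <;> linarith [hφ.1, hφ.2]
            have := hh' φ
            gcongr
        _ = _ := by rw [hM1]; field_simp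
    have t2 : (4 + 2 / β) * q ^ β * h φ ≤ M2 * (q * X ^ p) * Q := by
      have hb2 : 4 + 2 / β ≤ M2 := by
        rw [hM2]
        have : 2 / β ≤ |2 / β| := le_abs_self _
        rw [abs_div, abs_two] at this
        linarith
      calc (4 + 2 / β) * q ^ β * h φ ≤ M2 * q ^ β * h φ := by
            have : 0 ≤ h φ := by simp only [hh]; positivity
            gcongr
        _ = _ := by rw [eβ]; ring
    have t3 : M1 * (X ^ (p - 1) * (q * Y)) * Q ≤
        κ ^ 2 / 4 * X ^ p * Q + M1 * ε1 ^ (1 - p) * (q ^ p * Y ^ p) * Q := by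
      calc _ ≤ M1 * (ε1 * X ^ p + ε1 ^ (1 - p) * (q ^ p * Y ^ p)) * Q := by gcongr
        _ = (M1 * ε1) * X ^ p * Q + M1 * ε1 ^ (1 - p) * (q ^ p * Y ^ p) * Q := by ring
        _ = _ := by
          rw [show M1 * ε1 = κ ^ 2 / 4 by rw [hε1]; field_simp]
    have t4 : M2 * (q * X ^ p) * Q ≤
        κ ^ 2 / 4 * X ^ p * Q + M2 * ε2 ^ (1 - p) * (q ^ p * X ^ p) * Q := by
      calc _ ≤ M2 * (ε2 * X ^ p + ε2 ^ (1 - p) * (q ^ p * X ^ p)) * Q := by gcongr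
        _ = (M2 * ε2) * X ^ p * Q + M2 * ε2 ^ (1 - p) * (q ^ p * X ^ p) * Q := by ring
        _ = _ := by
          rw [show M2 * ε2 = κ ^ 2 / 4 by rw [hε2]; field_simp]
    have t5 : C0 * ((Y ^ p + X ^ p) * q ^ b) =
        M1 * ε1 ^ (1 - p) * (q ^ p * Y ^ p) * Q + M2 * ε2 ^ (1 - p) * (q ^ p * X ^ p) * Q +
        (M1 * ε1 ^ (1 - p) * (q ^ p * X ^ p) * Q + M2 * ε2 ^ (1 - p) * (q ^ p * Y ^ p) * Q) := by
      rw [hC0, eb]; ring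
    have t6 : 0 ≤ (M1 * ε1 ^ (1 - p) * (q ^ p * X ^ p) * Q +
        M2 * ε2 ^ (1 - p) * (q ^ p * Y ^ p) * Q) := by positivity
    have t7 : W' φ = deriv h φ * (q ^ β * (κ - 2 * φ) / β) + X ^ p * κ ^ 2 * Q -
        (4 + 2 / β) * q ^ β * h φ := by
      simp only [hW']
      rw [← hqdef, eβ1]
      ring
    have t8 : h φ = X ^ p := rfl
    rw [t5, t7]
    rw [t8] at *
    linarith
  -- integrate
  have hcL : ContinuousOn (fun φ => h φ * qf κ φ ^ (b - p)) (Icc s t) :=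
    hhc.continuousOn.mul (hqr _)
  have hcR : ContinuousOn (fun φ => (‖deriv f φ‖ ^ p + ‖f φ‖ ^ p) * qf κ φ ^ b) (Icc s t) :=
    (hfc.add hhc).continuousOn.mul (hqr _)
  have hint : ∫ φ in s..t, W' φ = 0 := by
    rw [intervalIntegral.integral_eq_sub_of_hasDerivAt (f := fun φ => h φ * (qf κ φ ^ β * (κ - 2 * φ) / β))]
    · simp [hh, hfs s hs0.le le_rfl, hft t le_rfl htκ.le, hp0.ne']
    · intro φ hφ
      rw [uIcc_of_le hst] at hφ
      exact hW φ hφ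
    · apply ContinuousOn.intervalIntegrable
      rwa [uIcc_of_le hst]
  have iL : IntervalIntegrable (fun φ => h φ * qf κ φ ^ (b - p)) volume s t := by
    apply ContinuousOn.intervalIntegrable; rwa [uIcc_of_le hst]
  have iR : IntervalIntegrable (fun φ => (‖deriv f φ‖ ^ p + ‖f φ‖ ^ p) * qf κ φ ^ b) volume s t := by
    apply ContinuousOn.intervalIntegrable; rwa [uIcc_of_le hst]
  have iW : IntervalIntegrable W' volume s t := by
    apply ContinuousOn.intervalIntegrable; rwa [uIcc_of_le hst]
  have main : κ ^ 2 / 2 * ∫ φ in s..t, h φ * qf κ φ ^ (b - p) ≤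
      C0 * ∫ φ in s..t, (‖deriv f φ‖ ^ p + ‖f φ‖ ^ p) * qf κ φ ^ b := by
    have := intervalIntegral.integral_mono_on hst ((iL.const_mul (κ ^ 2 / 2)).sub iW)
      (iR.const_mul C0) hpt
    rw [intervalIntegral.integral_sub (iL.const_mul _) iW, hint,
      intervalIntegral.integral_const_mul, intervalIntegral.integral_const_mul] at this
    linarith
  have main2 : ∫ φ in s..t, h φ * qf κ φ ^ (b - p) ≤
      C0 / (κ ^ 2 / 2) * ∫ φ in s..t, (‖deriv f φ‖ ^ p + ‖f φ‖ ^ p) * qf κ φ ^ b := by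
    rw [div_mul_eq_mul_div, le_div_iff₀ (by positivity)]
    linarith
  rw [intervalIntegral.integral_of_le hst, intervalIntegral.integral_of_le hst] at main2
  have hsub : Ioc s t ⊆ Ioo 0 κ := fun φ hφ => ⟨by linarith [hφ.1], by linarith [hφ.2]⟩
  calc ∫⁻ φ in Ioo 0 κ, ENNReal.ofReal (‖f φ‖ ^ p * qf κ φ ^ (b - p))
      ≤ ∫⁻ φ in Ioc s t, ENNReal.ofReal (h φ * qf κ φ ^ (b - p)) := by
        rw [← lintegral_indicator measurableSet_Ioo, ← lintegral_indicator measurableSet_Ioc]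
        apply lintegral_mono
        intro φ
        by_cases h1 : φ ∈ Ioo 0 κ
        · by_cases h2 : φ ∈ Ioc s t
          · simp [h1, h2, hh]
          · have : f φ = 0 := by
              rcases le_or_gt φ s with h3 | h3
              · exact hfs φ h1.1.le h3
              · rcases le_or_gt φ t with h4 | h4
                · exact absurd ⟨h3, h4⟩ h2
                · exact hft φ h4.le h1.2.le
            simp [h1, h2, this, hp0.ne']
        · simp [h1]
    _ = ENNReal.ofReal (∫ φ in Ioc s t, h φ * qf κ φ ^ (b - p)) := by
        rw [ofReal_integral_eq_lintegral_ofReal]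
        · exact ((intervalIntegrable_iff_integrableOn_Ioc_of_le hst).1 iL)
        · refine (ae_restrict_iff' measurableSet_Ioc).2 (Filter.Eventually.of_forall fun φ hφ => ?_)
          have := hq φ (Ioc_subset_Icc_self hφ)
          simp only [hh, Pi.zero_apply]; positivity
    _ ≤ ENNReal.ofReal (C0 / (κ ^ 2 / 2) *
          ∫ φ in Ioc s t, (‖deriv f φ‖ ^ p + ‖f φ‖ ^ p) * qf κ φ ^ b) :=
        ENNReal.ofReal_le_ofReal main2
    _ = ENNReal.ofReal (C0 / (κ ^ 2 / 2)) *
          ∫⁻ φ in Ioc s t, ENNReal.ofReal ((‖deriv f φ‖ ^ p + ‖f φ‖ ^ p) * qf κ φ ^ b) := by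
        rw [ENNReal.ofReal_mul (by positivity), ofReal_integral_eq_lintegral_ofReal]
        · exact ((intervalIntegrable_iff_integrableOn_Ioc_of_le hst).1 iR)
        · refine (ae_restrict_iff' measurableSet_Ioc).2 (Filter.Eventually.of_forall fun φ hφ => ?_)
          have := hq φ (Ioc_subset_Icc_self hφ)
          simp only [Pi.zero_apply]; positivity
    _ ≤ _ := by
        gcongr
lemma pd1_eq {f : ℝ × ℝ → ℂ} (hf : Differentiable ℝ f) :
    pd1 f = fun x => fderiv ℝ f x (1, 0) := by
  funext x
  have h1 : HasDerivAt (fun s : ℝ => ((s, x.2) : ℝ × ℝ)) (1, 0) x.1 :=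
    (hasDerivAt_id x.1).prodMk (hasDerivAt_const x.1 x.2)
  have := (hf (x.1, x.2)).hasFDerivAt.comp_hasDerivAt x.1 h1
  exact this.deriv

lemma pd2_eq {f : ℝ × ℝ → ℂ} (hf : Differentiable ℝ f) :
    pd2 f = fun x => fderiv ℝ f x (0, 1) := by
  funext x
  have h1 : HasDerivAt (fun s : ℝ => ((x.1, s) : ℝ × ℝ)) (0, 1) x.2 :=
    (hasDerivAt_const x.2 x.1).prodMk (hasDerivAt_id x.2)
  have := (hf (x.1, x.2)).hasFDerivAt.comp_hasDerivAt x.2 h1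
  exact this.deriv

/-- smooth and supported in the domain -/
def Good (κ : ℝ) (f : ℝ × ℝ → ℂ) : Prop := ContDiff ℝ (⊤ : ℕ∞) f ∧ tsupport f ⊆ D2 κ

lemma smooth_diff {f : ℝ × ℝ → ℂ} (h : ContDiff ℝ (⊤ : ℕ∞) f) : Differentiable ℝ f :=
  h.differentiable (by simp)

lemma good_dir {κ : ℝ} {f : ℝ × ℝ → ℂ} (h : Good κ f) (e : ℝ × ℝ) :
    Good κ (fun x => fderiv ℝ f x e) := by
  constructor
  · have := h.1.fderiv_right (m := (⊤ : ℕ∞)) (by simp)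
    exact this.clm_apply contDiff_const
  · refine Subset.trans ?_ h.2
    refine Subset.trans (closure_mono ?_) (tsupport_fderiv_subset ℝ (f := f))
    intro x hx
    simp only [Function.mem_support] at *
    intro h0
    exact hx (by simp [h0])

lemma good_pd1 {κ : ℝ} {f : ℝ × ℝ → ℂ} (h : Good κ f) : Good κ (pd1 f) := by
  rw [pd1_eq (smooth_diff h.1)]; exact good_dir h _

lemma good_pd2 {κ : ℝ} {f : ℝ × ℝ → ℂ} (h : Good κ f) : Good κ (pd2 f) := by
  rw [pd2_eq (smooth_diff h.1)]; exact good_dir h _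

lemma good_pd1_iter {κ : ℝ} {f : ℝ × ℝ → ℂ} (h : Good κ f) (n : ℕ) : Good κ (pd1^[n] f) := by
  induction n with
  | zero => exact h
  | succ n ih => rw [Function.iterate_succ_apply']; exact good_pd1 ih

lemma good_pdMix {κ : ℝ} {f : ℝ × ℝ → ℂ} (h : Good κ f) (α : ℕ × ℕ) : Good κ (pdMix α f) := by
  have : ∀ n, Good κ (pd2^[n] f) := by
    intro n
    induction n with
    | zero => exact h
    | succ n ih => rw [Function.iterate_succ_apply']; exact good_pd2 ih
  exact good_pd1_iter (this _) _

lemma pd_comm {κ : ℝ} {f : ℝ × ℝ → ℂ} (h : Good κ f) : pd2 (pd1 f) = pd1 (pd2 f) := by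
  have hd := smooth_diff h.1
  rw [pd2_eq (smooth_diff (good_pd1 h).1), pd1_eq (smooth_diff (good_pd2 h).1)]
  rw [pd1_eq hd, pd2_eq hd]
  funext x
  have hs : IsSymmSndFDerivAt ℝ f x := h.1.contDiffAt.isSymmSndFDerivAt (by
    rw [minSmoothness_of_isRCLikeNormedField]; exact WithTop.coe_le_coe.2 (le_top : (2 : ℕ∞) ≤ ⊤))
  have h2 : Differentiable ℝ (fderiv ℝ f) :=
    (h.1.fderiv_right (m := (⊤ : ℕ∞)) (by simp)).differentiable (by simp)
  rw [fderiv_clm_apply (h2 x) (differentiableAt_const _),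
    fderiv_clm_apply (h2 x) (differentiableAt_const _)]
  simpa using hs (0, 1) (1, 0)

lemma pd2_iter_comm {κ : ℝ} {f : ℝ × ℝ → ℂ} (h : Good κ f) (n : ℕ) :
    pd2 (pd1^[n] f) = pd1^[n] (pd2 f) := by
  induction n with
  | zero => rfl
  | succ n ih =>
    rw [Function.iterate_succ_apply', Function.iterate_succ_apply', pd_comm (good_pd1_iter h n), ih]

lemma pd1_pdMix (α : ℕ × ℕ) (f : ℝ × ℝ → ℂ) : pd1 (pdMix α f) = pdMix (α.1 + 1, α.2) f := by
  simp only [pdMix, Function.iterate_succ_apply']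

lemma pd2_pdMix {κ : ℝ} (α : ℕ × ℕ) {f : ℝ × ℝ → ℂ} (h : Good κ f) :
    pd2 (pdMix α f) = pdMix (α.1, α.2 + 1) f := by
  have h2 : Good κ (pd2^[α.2] f) := good_pdMix h (0, α.2)
  simp only [pdMix, Function.iterate_succ_apply']
  exact pd2_iter_comm h2 _

/-- the integrand in polar coordinates -/
def pint (κ p g n : ℝ) (v : ℝ × ℝ → ℂ) (z : ℝ × ℝ) : ℝ≥0∞ :=
  ENNReal.ofReal (z.1 * (‖v (z.1 * cos z.2, z.1 * sin z.2)‖ ^ p * (z.1 ^ n * qf κ z.2 ^ g)))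

lemma measurable_pint (κ p g n : ℝ) {v : ℝ × ℝ → ℂ} (hv : Continuous v) :
    Measurable (pint κ p g n v) := by
  have h1 : Measurable (fun z : ℝ × ℝ => v (z.1 * cos z.2, z.1 * sin z.2)) :=
    (hv.comp (by fun_prop : Continuous fun z : ℝ × ℝ => (z.1 * cos z.2, z.1 * sin z.2))).measurable
  unfold pint qf
  fun_prop

lemma weight_compare {κ : ℝ} (hκ : 0 < κ) (hκ' : κ < 2 * π) (p g n : ℝ) : ∃ K : ℝ, 0 < K ∧
    ∀ v : ℝ × ℝ → ℂ,
      (∫⁻ x in D2 κ, ENNReal.ofReal (‖v x‖ ^ p * wgt2 κ g n x)) ≤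
        ENNReal.ofReal K * ∫⁻ z in Ioi (0:ℝ) ×ˢ Ioo 0 κ, pint κ p g n v z ∧
      (∫⁻ z in Ioi (0:ℝ) ×ˢ Ioo 0 κ, pint κ p g n v z) ≤
        ENNReal.ofReal K * ∫⁻ x in D2 κ, ENNReal.ofReal (‖v x‖ ^ p * wgt2 κ g n x) := by
  obtain ⟨K, hK, h⟩ := wgt2_compare hκ hκ' g n
  refine ⟨K, hK, fun v => ?_⟩
  have hm : MeasurableSet (Ioi (0:ℝ) ×ˢ Ioo (0:ℝ) κ) := measurableSet_Ioi.prod measurableSet_Ioo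
  rw [lintegral_D2 hκ']
  rw [← lintegral_const_mul' _ _ ENNReal.ofReal_ne_top,
    ← lintegral_const_mul' _ _ ENNReal.ofReal_ne_top]
  constructor
  · apply setLIntegral_mono' hm
    rintro ⟨r, φ⟩ ⟨hr, h0, h1⟩
    simp only [mem_Ioi] at hr h0 h1
    unfold pint
    rw [← ENNReal.ofReal_mul hr.le, ← ENNReal.ofReal_mul hK.le]
    apply ENNReal.ofReal_le_ofReal
    have := (h r φ hr h0 h1).1
    calc _ ≤ r * (‖v (r * cos φ, r * sin φ)‖ ^ p * (K * (r ^ n * qf κ φ ^ g))) := by gcongr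
      _ = _ := by ring
  · apply setLIntegral_mono' hm
    rintro ⟨r, φ⟩ ⟨hr, h0, h1⟩
    simp only [mem_Ioi] at hr h0 h1
    unfold pint
    rw [← ENNReal.ofReal_mul hr.le, ← ENNReal.ofReal_mul hK.le]
    apply ENNReal.ofReal_le_ofReal
    have := (h r φ hr h0 h1).2
    calc _ ≤ r * (‖v (r * cos φ, r * sin φ)‖ ^ p *
            (K * wgt2 κ g n (r * cos φ, r * sin φ))) := by gcongr
      _ = _ := by ring

lemma hardy_polar {κ p b N : ℝ} (hκ : 0 < κ) (hκ' : κ < 2 * π) (hp : 1 < p) (hb : b ≠ p - 1) :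
    ∃ C : ℝ, 0 < C ∧ ∀ v : ℝ × ℝ → ℂ, Good κ v →
      (∫⁻ z in Ioi (0:ℝ) ×ˢ Ioo 0 κ, pint κ p (b - p) N v z) ≤ ENNReal.ofReal C *
        ((∫⁻ z in Ioi (0:ℝ) ×ˢ Ioo 0 κ, pint κ p b (N + p) (pd1 v) z) +
         (∫⁻ z in Ioi (0:ℝ) ×ˢ Ioo 0 κ, pint κ p b (N + p) (pd2 v) z) +
         (∫⁻ z in Ioi (0:ℝ) ×ˢ Ioo 0 κ, pint κ p b N v z)) := by
  obtain ⟨C, hC, H⟩ := hardy1 hκ hp hb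
  have hp0 : 0 < p := by linarith
  refine ⟨C * (2 ^ p), by positivity, fun v hv => ?_⟩
  have m0 := measurable_pint κ p (b - p) N hv.1.continuous
  have m1 := measurable_pint κ p b (N + p) (good_pd1 hv).1.continuous
  have m2 := measurable_pint κ p b (N + p) (good_pd2 hv).1.continuous
  have m3 := measurable_pint κ p b N hv.1.continuous
  rw [← lintegral_add_left m1, ← lintegral_add_right _ m3,
    ← lintegral_const_mul' _ _ ENNReal.ofReal_ne_top, Measure.volume_eq_prod,
    setLIntegral_prod _ m0.aemeasurable,
    setLIntegral_prod (fun a => ENNReal.ofReal (C * 2 ^ p) *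
        (pint κ p b (N + p) (pd1 v) a + pint κ p b (N + p) (pd2 v) a + pint κ p b N v a)) (((m1.add m2).add m3).const_mul _).aemeasurable]
  apply setLIntegral_mono' measurableSet_Ioi
  intro r hr
  simp only [mem_Ioi] at hr
  have hdv := smooth_diff hv.1
  set f : ℝ → ℂ := fun φ => v (r * cos φ, r * sin φ) with hf
  have hfC : ContDiff ℝ 1 f := by
    have h1 : ContDiff ℝ 1 (fun φ : ℝ => ((r * cos φ, r * sin φ) : ℝ × ℝ)) := by fun_prop
    exact (hv.1.of_le (by simp)).comp h1
  have hz : ∀ t, (t = 0 ∨ t = κ) → ∀ᶠ φ in nhds t, f φ = 0 := by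
    intro t ht
    have h1 : Continuous (fun φ : ℝ => ((r * cos φ, r * sin φ) : ℝ × ℝ)) := by fun_prop
    have h2 : (r * cos t, r * sin t) ∉ tsupport v := fun h => not_mem_D2 hκ' hr ht (hv.2 h)
    have h3 := (h1.tendsto t).eventually ((isClosed_tsupport v).isOpen_compl.mem_nhds h2)
    filter_upwards [h3] with φ hφ
    exact image_eq_zero_of_notMem_tsupport (f := v) hφ
  have H1 := H f hfC (hz 0 (Or.inl rfl)) (hz κ (Or.inr rfl))
  have hder : ∀ φ, ‖deriv f φ‖ ≤ r * (‖pd1 v (r * cos φ, r * sin φ)‖ + ‖pd2 v (r * cos φ, r * sin φ)‖) := by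
    intro φ
    have h1 : HasDerivAt (fun φ : ℝ => ((r * cos φ, r * sin φ) : ℝ × ℝ))
        (r * (-sin φ), r * cos φ) φ :=
      ((hasDerivAt_cos φ).const_mul r).prodMk ((hasDerivAt_sin φ).const_mul r)
    have h2 := (hdv (r * cos φ, r * sin φ)).hasFDerivAt.comp_hasDerivAt φ h1
    have h3 : deriv f φ = _ := h2.deriv
    rw [h3, show ((r * (-sin φ), r * cos φ) : ℝ × ℝ) =
      (r * (-sin φ)) • (1, 0) + (r * cos φ) • (0, 1) by simp, map_add, map_smul, map_smul,
      pd1_eq hdv, pd2_eq hdv]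
    refine (norm_add_le _ _).trans ?_
    rw [norm_smul, norm_smul, norm_mul, norm_mul, Real.norm_eq_abs, Real.norm_eq_abs,
      Real.norm_eq_abs, abs_neg, abs_of_pos hr, mul_add]
    have := abs_sin_le_one φ
    have := abs_cos_le_one φ
    gcongr
    · exact mul_le_of_le_one_right hr.le (by assumption)
    · exact mul_le_of_le_one_right hr.le (by assumption)
  calc ∫⁻ φ in Ioo 0 κ, pint κ p (b - p) N v (r, φ)
      = ENNReal.ofReal (r * r ^ N) * ∫⁻ φ in Ioo 0 κ, ENNReal.ofReal (‖f φ‖ ^ p * qf κ φ ^ (b - p)) := by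
        rw [← lintegral_const_mul' _ _ ENNReal.ofReal_ne_top]
        congr 1
        funext φ
        rw [← ENNReal.ofReal_mul (by positivity)]
        unfold pint
        congr 1
        simp only [hf]; ring
    _ ≤ ENNReal.ofReal (r * r ^ N) * (ENNReal.ofReal C *
        ∫⁻ φ in Ioo 0 κ, ENNReal.ofReal ((‖deriv f φ‖ ^ p + ‖f φ‖ ^ p) * qf κ φ ^ b)) := by
        gcongr
    _ = ∫⁻ φ in Ioo 0 κ, ENNReal.ofReal (r * r ^ N * (C *
          ((‖deriv f φ‖ ^ p + ‖f φ‖ ^ p) * qf κ φ ^ b))) := by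
        rw [← lintegral_const_mul' _ _ ENNReal.ofReal_ne_top,
          ← lintegral_const_mul' _ _ ENNReal.ofReal_ne_top]
        congr 1
        funext φ
        rw [← ENNReal.ofReal_mul hC.le, ← ENNReal.ofReal_mul (by positivity)]
    _ ≤ _ := by
        apply setLIntegral_mono' measurableSet_Ioo
        intro φ hφ
        have hq : 0 < qf κ φ := mul_pos hφ.1 (sub_pos.2 hφ.2)
        unfold pint
        simp only
        set A := ‖pd1 v (r * cos φ, r * sin φ)‖
        set B := ‖pd2 v (r * cos φ, r * sin φ)‖
        have hA : 0 ≤ A := norm_nonneg _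
        have hB : 0 ≤ B := norm_nonneg _
        rw [← ENNReal.ofReal_add (by positivity) (by positivity),
          ← ENNReal.ofReal_add (by positivity) (by positivity),
          ← ENNReal.ofReal_mul (by positivity)]
        apply ENNReal.ofReal_le_ofReal
        have hAB : (A + B) ^ p ≤ 2 ^ p * (A ^ p + B ^ p) := by
          have h1 : A + B ≤ 2 * max A B := by
            linarith [le_max_left A B, le_max_right A B]
          have h2 : (A + B) ^ p ≤ (2 * max A B) ^ p := by gcongr
          rw [mul_rpow (by norm_num) (le_max_of_le_left hA)] at h2
          refine h2.trans ?_
          gcongr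
          rcases max_choice A B with h | h <;> rw [h]
          · have : 0 ≤ B ^ p := by positivity
            linarith
          · have : 0 ≤ A ^ p := by positivity
            linarith
        have h1 : ‖deriv f φ‖ ^ p ≤ r ^ p * (2 ^ p * (A ^ p + B ^ p)) := by
          calc ‖deriv f φ‖ ^ p ≤ (r * (A + B)) ^ p := by
                have := hder φ
                gcongr
            _ = r ^ p * (A + B) ^ p := by rw [mul_rpow hr.le (by positivity)]
            _ ≤ _ := by gcongr
        have h2 : (1:ℝ) ≤ 2 ^ p := Real.one_le_rpow (by norm_num) hp0.le
        have h3 : ‖f φ‖ ^ p ≤ 2 ^ p * ‖f φ‖ ^ p := le_mul_of_one_le_left (by positivity) h2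
        calc _ ≤ r * r ^ N * (C * ((r ^ p * (2 ^ p * (A ^ p + B ^ p)) + 2 ^ p * ‖f φ‖ ^ p) * qf κ φ ^ b)) := by
              gcongr
          _ = _ := by
              rw [rpow_add hr]
              simp only [hf]
              ring

lemma hardy2 {κ p b N : ℝ} (hκ : 0 < κ) (hκ' : κ < 2 * π) (hp : 1 < p) (hb : b ≠ p - 1) :
    ∃ C : ℝ≥0∞, C ≠ ⊤ ∧ ∀ v : ℝ × ℝ → ℂ, Good κ v →
      (∫⁻ x in D2 κ, ENNReal.ofReal (‖v x‖ ^ p * wgt2 κ (b - p) N x)) ≤ C *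
        ((∫⁻ x in D2 κ, ENNReal.ofReal (‖pd1 v x‖ ^ p * wgt2 κ b (N + p) x)) +
         (∫⁻ x in D2 κ, ENNReal.ofReal (‖pd2 v x‖ ^ p * wgt2 κ b (N + p) x)) +
         (∫⁻ x in D2 κ, ENNReal.ofReal (‖v x‖ ^ p * wgt2 κ b N x))) := by
  obtain ⟨C, hC, H⟩ := hardy_polar (N := N) hκ hκ' hp hb
  obtain ⟨K1, -, W1⟩ := weight_compare hκ hκ' p (b - p) N
  obtain ⟨K2, -, W2⟩ := weight_compare hκ hκ' p b (N + p)
  obtain ⟨K3, -, W3⟩ := weight_compare hκ hκ' p b N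
  refine ⟨ENNReal.ofReal K1 * (ENNReal.ofReal C * (ENNReal.ofReal K2 + ENNReal.ofReal K3)), ?_,
    fun v hv => ?_⟩
  · exact ENNReal.mul_ne_top ENNReal.ofReal_ne_top (ENNReal.mul_ne_top ENNReal.ofReal_ne_top
      (ENNReal.add_ne_top.2 ⟨ENNReal.ofReal_ne_top, ENNReal.ofReal_ne_top⟩))
  refine (W1 v).1.trans ?_
  rw [mul_assoc, mul_assoc]
  gcongr
  refine (H v hv).trans ?_
  gcongr
  rw [mul_add, mul_add]
  gcongr ?_ + ?_ + ?_
  · refine (W2 _).2.trans ?_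
    gcongr; exact le_self_add
  · refine (W2 _).2.trans ?_
    gcongr; exact le_self_add
  · refine (W3 _).2.trans ?_
    gcongr; exact le_add_self
/-- intermediate weighted integrals -/
def AA (κ p γ ν : ℝ) (k : ℕ) (m : ℕ) (α : ℕ × ℕ) (u : ℝ × ℝ → ℂ) : ℝ≥0∞ :=
  ∫⁻ x in D2 κ, ENNReal.ofReal
    (‖pdMix α u x‖ ^ p * wgt2 κ (γ - m * p) (ν + ((α.1 + α.2 : ℝ) - k) * p) x)

lemma mem_idx {k : ℕ} {α : ℕ × ℕ} : α ∈ idx k ↔ α.1 + α.2 ≤ k := by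
  simp only [idx, Finset.mem_filter, Finset.mem_product, Finset.mem_range]
  constructor
  · exact fun h => h.2
  · intro h; exact ⟨⟨by omega, by omega⟩, h⟩

lemma AA_bound {κ : ℝ} (hκ : 0 < κ) (hκ' : κ < 2 * π)
    (p γ ν : ℝ) (hp : 1 < p) (k : ℕ)
    (hγ1 : ((k : ℝ) - 1) * p - 1 < γ) (hγ2 : γ < (k : ℝ) * p - 1) (m : ℕ) :
    ∀ α : ℕ × ℕ, α.1 + α.2 + m ≤ k → ∃ C : ℝ≥0∞, C ≠ ⊤ ∧ ∀ u, Good κ u →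
      AA κ p γ ν k m α u ≤ C * ∑ β ∈ idx k, AA κ p γ ν k 0 β u := by
  induction m with
  | zero =>
    intro α hα
    refine ⟨1, ENNReal.one_ne_top, fun u _ => ?_⟩
    rw [one_mul]
    exact Finset.single_le_sum (f := fun β => AA κ p γ ν k 0 β u) (fun _ _ => bot_le)
      (mem_idx.2 (by omega))
  | succ m ih =>
    intro α hα
    have hb : γ - m * p ≠ p - 1 := by
      intro h
      have h1 : γ = (m + 1) * p - 1 := by linarith
      rw [h1] at hγ1 hγ2
      have h2 : ((m + 1 : ℕ) : ℝ) < k := by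
        push_cast
        exact lt_of_mul_lt_mul_right (by linarith) (by linarith : (0:ℝ) ≤ p)
      have h3 : m + 2 ≤ k := by exact_mod_cast h2
      have h4 : ((m + 2 : ℕ) : ℝ) ≤ k := by exact_mod_cast h3
      push_cast at h4
      nlinarith
    obtain ⟨C, hC, H⟩ := hardy2 (N := ν + ((α.1 + α.2 : ℝ) - k) * p) hκ hκ' hp hb
    obtain ⟨C1, hC1, H1⟩ := ih (α.1 + 1, α.2) (by simp only; omega)
    obtain ⟨C2, hC2, H2⟩ := ih (α.1, α.2 + 1) (by simp only; omega)
    obtain ⟨C3, hC3, H3⟩ := ih α (by omega)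
    refine ⟨C * (C1 + C2 + C3), ENNReal.mul_ne_top hC (by simp [hC1, hC2, hC3]), fun u hu => ?_⟩
    have h := H (pdMix α u) (good_pdMix hu α)
    rw [pd1_pdMix, pd2_pdMix α hu] at h
    have e0 : γ - (m + 1 : ℕ) * p = γ - m * p - p := by push_cast; ring
    have e1 : ν + ((α.1 + α.2 : ℝ) - k) * p + p = ν + (((α.1 + 1 : ℕ) + α.2 : ℝ) - k) * p := by
      push_cast; ring
    have e2 : ν + ((α.1 + α.2 : ℝ) - k) * p + p = ν + ((α.1 + (α.2 + 1 : ℕ) : ℝ) - k) * p := by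
      push_cast; ring
    have g1 := H1 u hu
    have g2 := H2 u hu
    have g3 := H3 u hu
    unfold AA at g1 g2 g3 ⊢
    simp only at g1 g2
    rw [← e1] at g1
    rw [← e2] at g2
    rw [e0, mul_assoc]
    refine h.trans ?_
    rw [add_mul, add_mul]
    gcongr

lemma easy_weight {κ : ℝ} (hκ : 0 < κ) (hκ' : κ < 2 * π) {g n e : ℝ} (he : e ≤ 0) {x : ℝ × ℝ}
    (hx : x ∈ D2 κ) : wgt2 κ g (n + e) x ≤ wgt2 κ (g + e) (n + e) x := by
  have hle := rhoD2_le_norm hκ x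
  obtain ⟨r, φ, hr, h0, h1, rfl⟩ := hx
  have hlow := rhoD2_lower hκ hr h0 h1 hκ'
  have hq : 0 < qf κ φ := mul_pos h0 (sub_pos.2 h1)
  have hpos : 0 < rhoD2 κ (r * cos φ, r * sin φ) := lt_of_lt_of_le (by positivity) hlow
  unfold wgt2
  rw [enorm2_polar hr.le] at *
  rw [show n + e - g = (n + e - (g + e)) + e by ring, rpow_add hr, rpow_add hpos]
  have := Real.rpow_le_rpow_of_nonpos hpos hle he
  calc _ = r ^ (n + e - (g + e)) * (rhoD2 κ (r * cos φ, r * sin φ) ^ g * r ^ e) := by ring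
    _ ≤ _ := by gcongr

theorem stmt15 (κ : ℝ) (hκ : 0 < κ) (hκ' : κ < 2 * π)
    (p γ ν : ℝ) (hp : 1 < p) (k : ℕ) (hk : 1 ≤ k)
    (hγ1 : ((k : ℝ) - 1) * p - 1 < γ) (hγ2 : γ < (k : ℝ) * p - 1) :
    ∃ c C : ℝ, 0 < c ∧ c ≤ C ∧
      ∀ u : ℝ × ℝ → ℂ, ContDiff ℝ (⊤ : ℕ∞) u → HasCompactSupport u → tsupport u ⊆ D2 κ →
        ENNReal.ofReal c *
            ∑ α ∈ idx k,
              (∫⁻ x in D2 κ, ENNReal.ofReal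
                (‖pdMix α u x‖ ^ p *
                  wgt2 κ (γ + ((α.1 + α.2 : ℝ) - k) * p) (ν + ((α.1 + α.2 : ℝ) - k) * p) x)) ^ (1 / p)
          ≤ ∑ α ∈ idx k,
              (∫⁻ x in D2 κ, ENNReal.ofReal
                (‖pdMix α u x‖ ^ p *
                  wgt2 κ γ (ν + ((α.1 + α.2 : ℝ) - k) * p) x)) ^ (1 / p) ∧
        ∑ α ∈ idx k,
            (∫⁻ x in D2 κ, ENNReal.ofReal
              (‖pdMix α u x‖ ^ p *
                wgt2 κ γ (ν + ((α.1 + α.2 : ℝ) - k) * p) x)) ^ (1 / p)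
          ≤ ENNReal.ofReal C *
              ∑ α ∈ idx k,
                (∫⁻ x in D2 κ, ENNReal.ofReal
                  (‖pdMix α u x‖ ^ p *
                    wgt2 κ (γ + ((α.1 + α.2 : ℝ) - k) * p) (ν + ((α.1 + α.2 : ℝ) - k) * p) x)) ^ (1 / p) := by
  have hp0 : 0 < p := by linarith
  have hb : ∀ α ∈ idx k, ∃ C : ℝ≥0∞, C ≠ ⊤ ∧ ∀ u, Good κ u →
      AA κ p γ ν k (k - (α.1 + α.2)) α u ≤ C * ∑ β ∈ idx k, AA κ p γ ν k 0 β u := by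
    intro α hα
    have := mem_idx.1 hα
    exact AA_bound hκ hκ' p γ ν hp k hγ1 hγ2 _ α (by omega)
  choose! K hKtop hK using hb
  have eL : ∀ α ∈ idx k, ∀ u : ℝ × ℝ → ℂ, (∫⁻ x in D2 κ, ENNReal.ofReal
      (‖pdMix α u x‖ ^ p *
        wgt2 κ (γ + ((α.1 + α.2 : ℝ) - k) * p) (ν + ((α.1 + α.2 : ℝ) - k) * p) x)) =
      AA κ p γ ν k (k - (α.1 + α.2)) α u := by
    intro α hα u
    unfold AA
    rw [Nat.cast_sub (mem_idx.1 hα)]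
    push_cast
    rw [show γ - ((k:ℝ) - (α.1 + α.2)) * p = γ + ((α.1 + α.2 : ℝ) - k) * p by ring]
  have eM : ∀ (α : ℕ × ℕ) (u : ℝ × ℝ → ℂ), (∫⁻ x in D2 κ, ENNReal.ofReal
      (‖pdMix α u x‖ ^ p * wgt2 κ γ (ν + ((α.1 + α.2 : ℝ) - k) * p) x)) =
      AA κ p γ ν k 0 α u := by
    intro α u
    unfold AA
    simp
  set T : ℝ≥0∞ := ∑ α ∈ idx k, (K α * (idx k).card) ^ (1 / p) with hT
  have hTtop : T ≠ ⊤ := by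
    rw [hT]
    refine ENNReal.sum_ne_top.2 fun α hα => ?_
    exact ENNReal.rpow_ne_top_of_nonneg (by positivity)
      (ENNReal.mul_ne_top (hKtop α hα) (ENNReal.natCast_ne_top _))
  have hard : ∀ u, Good κ u →
      ∑ α ∈ idx k, (AA κ p γ ν k (k - (α.1 + α.2)) α u) ^ (1 / p) ≤
        T * ∑ α ∈ idx k, (AA κ p γ ν k 0 α u) ^ (1 / p) := by
    intro u hu
    set S := ∑ α ∈ idx k, (AA κ p γ ν k 0 α u) ^ (1 / p) with hS
    rw [hT, Finset.sum_mul]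
    apply Finset.sum_le_sum
    intro α hα
    have h1 : ∀ β ∈ idx k, AA κ p γ ν k 0 β u ≤ S ^ p := by
      intro β hβ
      have h2 : (AA κ p γ ν k 0 β u) ^ (1 / p) ≤ S :=
        Finset.single_le_sum (f := fun β => (AA κ p γ ν k 0 β u) ^ (1 / p))
          (fun _ _ => bot_le) hβ
      have h3 := ENNReal.rpow_le_rpow h2 hp0.le
      rwa [← ENNReal.rpow_mul, one_div_mul_cancel hp0.ne', ENNReal.rpow_one] at h3
    have h2 : ∑ β ∈ idx k, AA κ p γ ν k 0 β u ≤ (idx k).card * S ^ p := by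
      have := Finset.sum_le_card_nsmul _ _ _ h1
      rwa [nsmul_eq_mul] at this
    have h3 : AA κ p γ ν k (k - (α.1 + α.2)) α u ≤ (K α * (idx k).card) * S ^ p := by
      refine (hK α hα u hu).trans ?_
      rw [mul_assoc]
      gcongr
    have h4 := ENNReal.rpow_le_rpow h3 (by positivity : 0 ≤ 1 / p)
    rwa [ENNReal.mul_rpow_of_nonneg _ _ (by positivity : 0 ≤ 1 / p), ← ENNReal.rpow_mul S,
      mul_one_div_cancel hp0.ne', ENNReal.rpow_one] at h4
  refine ⟨1 / (T.toReal + 1), 1, by positivity, ?_, fun u hu _ hsupp => ⟨?_, ?_⟩⟩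
  · rw [div_le_one (by positivity)]
    linarith [ENNReal.toReal_nonneg (a := T)]
  · have hg : Good κ u := ⟨hu, hsupp⟩
    simp only [eM]
    rw [Finset.sum_congr rfl (fun α hα => by rw [eL α hα u])]
    have hc : ENNReal.ofReal (1 / (T.toReal + 1)) * T ≤ 1 := by
      conv_lhs => rw [← ENNReal.ofReal_toReal hTtop]
      rw [ENNReal.toReal_ofReal ENNReal.toReal_nonneg,
        ← ENNReal.ofReal_mul (by positivity)]
      rw [← ENNReal.ofReal_one]
      apply ENNReal.ofReal_le_ofReal
      rw [one_div_mul_eq_div, div_le_one (by positivity)]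
      linarith
    calc _ ≤ ENNReal.ofReal (1 / (T.toReal + 1)) *
          (T * ∑ α ∈ idx k, (AA κ p γ ν k 0 α u) ^ (1 / p)) := by
          gcongr
          exact hard u hg
      _ ≤ 1 * ∑ α ∈ idx k, (AA κ p γ ν k 0 α u) ^ (1 / p) := by
          rw [← mul_assoc]
          gcongr
      _ = _ := one_mul _
  · rw [ENNReal.ofReal_one, one_mul]
    apply Finset.sum_le_sum
    intro α hα
    apply ENNReal.rpow_le_rpow _ (by positivity)
    apply setLIntegral_mono' (isOpen_D2 κ).measurableSet
    intro x hx
    apply ENNReal.ofReal_le_ofReal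
    have hα' : ((α.1 + α.2 : ℕ) : ℝ) ≤ k := by exact_mod_cast mem_idx.1 hα
    push_cast at hα'
    have he : ((α.1 + α.2 : ℝ) - k) * p ≤ 0 :=
      mul_nonpos_of_nonpos_of_nonneg (by linarith) hp0.le
    have := easy_weight hκ hκ' (g := γ) (n := ν) he hx
    gcongr
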